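/- There exists a universal constant C > 0 with the following property. Let l ≥ 0 and N ≥ 2 be integers, Δ = 2^l, let 2 ≤ k ≤ N be an integer, and let μ, ν : {0,…,Δ−1}² → ℝ≥0 each sum to 1, with every value of μ and of ν an integer multiple of 1/N, and with |supp(μ)| ≤ k. If s is chosen uniformly at random from {0, 1, …, Δ−1}², then with probability at least 0.99, ‖G_s(μ − ν)‖₁ ≤ C·(log₂ k + log₂ log₂ N)·EMD(μ, ν). -/

import Mathlib

open scoped Classical

/-- The cell of the grid `𝒢_{s,j}` (corner `s`, side `2^j`) containing a point `p`. -/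
noncomputable def cellOf (s : ℤ × ℤ) (j : ℕ) (p : ℝ × ℝ) : ℤ × ℤ :=
  (⌊(p.1 - (s.1 : ℝ)) / 2 ^ j⌋, ⌊(p.2 - (s.2 : ℝ)) / 2 ^ j⌋)

/-- A grid point of `{0,…,Δ−1}²` seen as a point of the plane. -/
noncomputable def toPlane {Δ : ℕ} (p : Fin Δ × Fin Δ) : ℝ × ℝ :=
  (((p.1 : ℕ) : ℝ), ((p.2 : ℕ) : ℝ))

/-- `‖G_s μ‖₁ = Σ_{j=0}^{l} 2^j Σ_{cells of 𝒢_{s,j}} |μ(cell)|`, the ℓ₁-norm of the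
grid embedding of a signed measure `μ` on `{0,…,2^l−1}²` with shift `s`. -/
noncomputable def gridEmbNorm (l : ℕ) (s : ℤ × ℤ) (μ : Fin (2 ^ l) × Fin (2 ^ l) → ℝ) : ℝ :=
  ∑ j ∈ Finset.range (l + 1), (2 : ℝ) ^ j *
    ∑ c ∈ Finset.univ.image (fun p : Fin (2 ^ l) × Fin (2 ^ l) => cellOf s j (toPlane p)),
      |∑ p ∈ Finset.univ.filter (fun p => cellOf s j (toPlane p) = c), μ p|

/-- The Earth Mover's Distance on `{0,…,Δ−1}²` with ground distance `‖p − q‖₁`: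
the infimum over couplings of the transportation cost. -/
noncomputable def EMDgrid (Δ : ℕ) (μ ν : Fin Δ × Fin Δ → ℝ) : ℝ :=
  sInf {c : ℝ | ∃ π : (Fin Δ × Fin Δ) → (Fin Δ × Fin Δ) → ℝ,
    (∀ p q, 0 ≤ π p q) ∧
    (∀ p, ∑ q, π p q = μ p) ∧
    (∀ q, ∑ p, π p q = ν q) ∧
    c = ∑ p, ∑ q, π p q *
      (|((p.1.1 : ℕ) : ℝ) - ((q.1.1 : ℕ) : ℝ)| + |((p.2.1 : ℕ) : ℝ) - ((q.2.1 : ℕ) : ℝ)|)}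

theorem sum_range_ediv_shift (m M : ℕ) (hm : 0 < m) (u : ℤ) (r : ℕ) :
    ∑ s ∈ Finset.range (M * m), ((u + r - s) / (m : ℤ) - (u - s) / (m : ℤ)) = r * M := by
  induction r with
  | zero => simp
  | succ r ih =>
    have hstep : ∑ s ∈ Finset.range (M * m),
        ((u + (r + 1 : ℕ) - s) / (m : ℤ) - (u + r - s) / (m : ℤ)) = M := by
      have h := Finset.sum_range_sub' (fun s : ℕ => (u + (r + 1 : ℕ) - s) / (m : ℤ)) (M * m)
      have hm' : (m : ℤ) ≠ 0 := by exact_mod_cast hm.ne'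
      have e : (u + (r + 1 : ℕ) - (M * m : ℕ)) / (m : ℤ) = (u + (r + 1 : ℕ)) / (m : ℤ) - M := by
        rw [show u + ((r + 1 : ℕ) : ℤ) - ((M * m : ℕ) : ℤ) = u + (r + 1 : ℕ) + (-M) * m by
          push_cast; ring, Int.add_mul_ediv_right _ _ hm']
        ring
      simp only [e] at h
      rw [show (M : ℤ) = (u + (r + 1 : ℕ) - (0 : ℕ)) / (m : ℤ)
        - ((u + (r + 1 : ℕ)) / (m : ℤ) - M) by simp, ← h]
      refine Finset.sum_congr rfl fun s _ => ?_
      congr 2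
      push_cast
      ring
    calc _ = ∑ s ∈ Finset.range (M * m),
        (((u + (r + 1 : ℕ) - s) / (m : ℤ) - (u + r - s) / (m : ℤ))
          + ((u + r - s) / (m : ℤ) - (u - s) / (m : ℤ))) :=
          Finset.sum_congr rfl fun s _ => by ring
      _ = _ := by rw [Finset.sum_add_distrib, hstep, ih]; push_cast; ring

/-- A random shift separates `u` from `u + r` in at most an `r / m` fraction of the cases. -/
theorem card_shift_separates_le (m M n : ℕ) (hm : 0 < m) (hn : n = M * m) (u : ℤ) (r : ℕ) :
    (Finset.univ.filter fun s : Fin n =>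
      (u - (s : ℕ)) / (m : ℤ) ≠ (u + r - (s : ℕ)) / (m : ℤ)).card ≤ r * M := by
  subst hn
  have h := sum_range_ediv_shift m M hm u r
  rw [← Fin.sum_univ_eq_sum_range
    (fun s : ℕ => ((u + r - s) / (m : ℤ) - (u - s) / (m : ℤ)))] at h
  have : ((Finset.univ.filter fun s : Fin (M * m) =>
      (u - (s : ℕ)) / (m : ℤ) ≠ (u + r - (s : ℕ)) / (m : ℤ)).card : ℤ) ≤ r * M := by
    rw [← h, Finset.card_filter]
    push_cast
    refine Finset.sum_le_sum fun s _ => ?_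
    have hle : (u - (s : ℕ)) / (m : ℤ) ≤ (u + r - (s : ℕ)) / (m : ℤ) :=
      Int.ediv_le_ediv (by exact_mod_cast hm) (by omega)
    split_ifs <;> omega
  exact_mod_cast this

/-- Integrality of optimal transport: for measures with weights in `ℕ / N`, some matching of `N`
atoms costs at most as much as every coupling. -/
theorem exists_matching {P : Type*} [Fintype P] [DecidableEq P] (c : P → P → ℝ) (N : ℕ)
    (hN : 0 < N) (μ ν : P → ℝ) (hμ : ∑ p, μ p = 1) (hν : ∑ p, ν p = 1)
    (hμN : ∀ p, ∃ a : ℕ, μ p = (a : ℝ) / N) (hνN : ∀ p, ∃ a : ℕ, ν p = (a : ℝ) / N) :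
    ∃ x y : Fin N → P,
      (∀ p, μ p = ((Finset.univ.filter fun i => x i = p).card : ℝ) / N) ∧
      (∀ p, ν p = ((Finset.univ.filter fun i => y i = p).card : ℝ) / N) ∧
      ∀ π : P → P → ℝ, (∀ p q, 0 ≤ π p q) → (∀ p, ∑ q, π p q = μ p) →
        (∀ q, ∑ p, π p q = ν q) → (∑ i, c (x i) (y i)) / N ≤ ∑ p, ∑ q, π p q * c p q := by
  have hN' : (N : ℝ) ≠ 0 := by exact_mod_cast hN.ne'
  have key : ∀ μ : P → ℝ, ∑ p, μ p = 1 → (∀ p, ∃ a : ℕ, μ p = (a : ℝ) / N) →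
      ∃ x : Fin N → P, ∀ p, μ p = ((Finset.univ.filter fun i => x i = p).card : ℝ) / N := by
    intro μ hμ hμN
    choose a ha using hμN
    have hcard : Fintype.card (Σ p, Fin (a p)) = N := by
      have : ((∑ p, a p : ℕ) : ℝ) = N := by
        simp only [ha, ← Finset.sum_div] at hμ
        push_cast
        field_simp at hμ
        exact hμ
      simpa using (by exact_mod_cast this : ∑ p, a p = N)
    let e := Fintype.equivFinOfCardEq hcard
    refine ⟨fun i => (e.symm i).1, fun p => ?_⟩
    rw [ha p]
    congr 2
    rw [← Fintype.card_subtype]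
    have e1 : {i : Fin N // (e.symm i).1 = p} ≃ {z : (Σ p, Fin (a p)) // z.1 = p} :=
      e.symm.subtypeEquiv fun _ => Iff.rfl
    rw [Fintype.card_congr (e1.trans (Equiv.sigmaSubtype p))]
    simp
  obtain ⟨x, hx⟩ := key μ hμ hμN
  obtain ⟨y, hy⟩ := key ν hν hνN
  obtain ⟨σ, -, hσ⟩ := Finset.exists_min_image (Finset.univ : Finset (Equiv.Perm (Fin N)))
    (fun σ => ∑ i, c (x i) (y (σ i))) ⟨1, Finset.mem_univ _⟩
  refine ⟨x, fun i => y (σ i), hx, fun q => ?_, fun π h0 h1 h2 => ?_⟩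
  · rw [hy q]
    congr 2
    exact (Finset.card_equiv σ (by simp)).symm
  have fib : ∀ (z : Fin N → P) (ρ : P → ℝ),
      (∀ p, ρ p = ((Finset.univ.filter fun i => z i = p).card : ℝ) / N) →
      ∀ f : P → ℝ, ∑ i, f (z i) = ∑ p, N * ρ p * f p := by
    intro z ρ hρ f
    rw [← Finset.sum_fiberwise (s := Finset.univ) (g := z)]
    refine Finset.sum_congr rfl fun p _ => ?_
    rw [Finset.sum_congr rfl (g := fun _ => f p) (by simp +contextual), hρ p,
      Finset.sum_const, nsmul_eq_mul, mul_div_cancel₀ _ hN']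
  have hμ0 : ∀ p, 0 ≤ μ p := fun p => by rw [hx p]; positivity
  have hν0 : ∀ p, 0 ≤ ν p := fun p => by rw [hy p]; positivity
  have zμ : ∀ p q, μ p = 0 → π p q = 0 := fun p q h =>
    (Finset.sum_eq_zero_iff_of_nonneg (fun q _ => h0 p q)).1 ((h1 p).trans h) q (Finset.mem_univ _)
  have zν : ∀ p q, ν q = 0 → π p q = 0 := fun p q h =>
    (Finset.sum_eq_zero_iff_of_nonneg (fun p _ => h0 p q)).1 ((h2 q).trans h) p (Finset.mem_univ _)
  have pos : ∀ (z : Fin N → P) (ρ : P → ℝ),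
      (∀ p, ρ p = ((Finset.univ.filter fun i => z i = p).card : ℝ) / N) → ∀ i, ρ (z i) ≠ 0 := by
    intro z ρ hρ i
    rw [hρ]
    have : 0 < (Finset.univ.filter fun j => z j = z i).card :=
      Finset.card_pos.2 ⟨i, by simp⟩
    positivity
  let M : Matrix (Fin N) (Fin N) ℝ := fun i j => π (x i) (y j) / (N * μ (x i) * ν (y j))
  have hM : M ∈ doublyStochastic ℝ (Fin N) := by
    rw [mem_doublyStochastic_iff_sum]
    refine ⟨fun i j => div_nonneg (h0 _ _) ?_, fun i => ?_, fun j => ?_⟩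
    · have := hμ0 (x i); have := hν0 (y j); positivity
    · have := pos x μ hx i
      rw [fib y ν hy (fun q => π (x i) q / (N * μ (x i) * ν q))]
      calc _ = ∑ q, π (x i) q / μ (x i) := Finset.sum_congr rfl fun q _ => by
            by_cases h : ν q = 0
            · simp [h, zν _ _ h]
            · field_simp
        _ = 1 := by rw [← Finset.sum_div, h1, div_self this]
    · have := pos y ν hy j
      rw [fib x μ hx (fun p => π p (y j) / (N * μ p * ν (y j)))]
      calc _ = ∑ p, π p (y j) / ν (y j) := Finset.sum_congr rfl fun q _ => by
            by_cases h : μ q = 0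
            · simp [h, zμ _ _ h]
            · field_simp
        _ = 1 := by rw [← Finset.sum_div, h2, div_self this]
  have hMc : ∑ i, ∑ j, M i j * c (x i) (y j) = N * ∑ p, ∑ q, π p q * c p q := by
    simp only [M]
    have : ∀ i, ∑ j, π (x i) (y j) / (N * μ (x i) * ν (y j)) * c (x i) (y j)
        = ∑ q, π (x i) q / μ (x i) * c (x i) q := by
      intro i
      rw [fib y ν hy (fun q => π (x i) q / (N * μ (x i) * ν q) * c (x i) q)]
      refine Finset.sum_congr rfl fun q _ => ?_
      by_cases h : ν q = 0
      · simp [h, zν _ _ h]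
      · field_simp
    simp only [this]
    rw [fib x μ hx (fun p => ∑ q, π p q / μ p * c p q), Finset.mul_sum]
    refine Finset.sum_congr rfl fun p _ => ?_
    rw [Finset.mul_sum, Finset.mul_sum]
    refine Finset.sum_congr rfl fun q _ => ?_
    by_cases h : μ p = 0
    · simp [h, zμ _ _ h]
    · field_simp
  obtain ⟨w, hw0, hw1, hw⟩ := exists_eq_sum_perm_of_mem_doublyStochastic hM
  rw [div_le_iff₀ (by positivity), mul_comm _ (N : ℝ), ← hMc, ← hw]
  calc ∑ i, c (x i) (y (σ i))
      = ∑ τ : Equiv.Perm (Fin N), w τ * ∑ i, c (x i) (y (σ i)) := by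
        rw [← Finset.sum_mul, hw1, one_mul]
    _ ≤ ∑ τ : Equiv.Perm (Fin N), w τ * ∑ i, c (x i) (y (τ i)) :=
        Finset.sum_le_sum fun τ _ => mul_le_mul_of_nonneg_left (hσ τ (Finset.mem_univ _)) (hw0 τ)
    _ = _ := by
        simp only [Matrix.sum_apply, Finset.sum_mul, Finset.mul_sum]
        rw [Finset.sum_comm]
        refine Finset.sum_congr rfl fun i _ => ?_
        rw [Finset.sum_comm]
        refine Finset.sum_congr rfl fun τ _ => ?_
        simp [Equiv.Perm.permMatrix, PEquiv.toMatrix_apply]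

/-- The cell of the shifted grid of side `2 ^ j` containing `p`, computed in the integers. -/
def gridCell {n : ℕ} (s : Fin n × Fin n) (j : ℕ) (p : Fin n × Fin n) : ℤ × ℤ :=
  ((((p.1 : ℕ) : ℤ) - (s.1 : ℕ)) / ((2 ^ j : ℕ) : ℤ),
    (((p.2 : ℕ) : ℤ) - (s.2 : ℕ)) / ((2 ^ j : ℕ) : ℤ))

/-- The `ℓ₁` distance between two grid points. -/
def gridDist {n : ℕ} (p q : Fin n × Fin n) : ℕ :=
  (((p.1 : ℕ) : ℤ) - (q.1 : ℕ)).natAbs + (((p.2 : ℕ) : ℤ) - (q.2 : ℕ)).natAbs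

theorem cast_gridDist {n : ℕ} (p q : Fin n × Fin n) :
    (gridDist p q : ℝ) =
      |((p.1 : ℕ) : ℝ) - ((q.1 : ℕ) : ℝ)| + |((p.2 : ℕ) : ℝ) - ((q.2 : ℕ) : ℝ)| := by
  simp [gridDist, Nat.cast_natAbs]

theorem cellOf_toPlane {n : ℕ} (s p : Fin n × Fin n) (j : ℕ) :
    cellOf (((s.1 : ℕ) : ℤ), ((s.2 : ℕ) : ℤ)) j (toPlane p) = gridCell s j p := by
  have h : ∀ a b : ℕ, ⌊((a : ℝ) - ((b : ℤ) : ℝ)) / 2 ^ j⌋ = ((a : ℤ) - b) / ((2 ^ j : ℕ) : ℤ) := by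
    intro a b
    have := Int.floor_div_natCast ((a : ℝ) - ((b : ℤ) : ℝ)) (2 ^ j)
    push_cast at this ⊢
    rw [this]
    congr 1
    exact_mod_cast Int.floor_intCast (R := ℝ) ((a : ℤ) - b)
  simp only [cellOf, toPlane, gridCell, h]

theorem gridCell_eq_of_le {n : ℕ} {s p q : Fin n × Fin n} {i j : ℕ} (hij : i ≤ j)
    (h : gridCell s i p = gridCell s i q) : gridCell s j p = gridCell s j q := by
  obtain ⟨t, rfl⟩ := Nat.exists_eq_add_of_le hij
  simp only [gridCell, Prod.mk.injEq] at h ⊢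
  have key : ∀ a : ℤ, a / ((2 ^ (i + t) : ℕ) : ℤ) = a / ((2 ^ i : ℕ) : ℤ) / ((2 ^ t : ℕ) : ℤ) := by
    intro a
    rw [pow_add, Nat.cast_mul, Int.ediv_ediv_of_nonneg (by positivity)]
  simp only [key, h.1, h.2, and_self]

theorem card_filter_or_le {n : ℕ} (A B : Fin n → Prop) [DecidablePred A] [DecidablePred B]
    [DecidablePred fun s : Fin n × Fin n => A s.1 ∨ B s.2] :
    (Finset.univ.filter fun s : Fin n × Fin n => A s.1 ∨ B s.2).card ≤
      (Finset.univ.filter A).card * n + (Finset.univ.filter B).card * n := by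
  have hsub : (Finset.univ.filter fun s : Fin n × Fin n => A s.1 ∨ B s.2) ⊆
      (Finset.univ.filter A ×ˢ Finset.univ) ∪ (Finset.univ ×ˢ Finset.univ.filter B) := by
    intro s
    simp
  refine (Finset.card_le_card hsub).trans ((Finset.card_union_le _ _).trans ?_)
  simp [Finset.card_product, mul_comm]

theorem card_coord_separates_le {l j : ℕ} (hj : j ≤ l) (u v : ℤ) (huv : u ≤ v) :
    2 ^ j * (Finset.univ.filter fun s : Fin (2 ^ l) =>
      (u - (s : ℕ)) / ((2 ^ j : ℕ) : ℤ) ≠ (v - (s : ℕ)) / ((2 ^ j : ℕ) : ℤ)).card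
        ≤ (v - u).natAbs * 2 ^ l := by
  have e : 2 ^ l = 2 ^ (l - j) * 2 ^ j := by rw [← pow_add, Nat.sub_add_cancel hj]
  have h := card_shift_separates_le (2 ^ j) (2 ^ (l - j)) (2 ^ l) (by positivity) e u (v - u).natAbs
  rw [show u + ((v - u).natAbs : ℤ) = v by omega] at h
  calc _ ≤ 2 ^ j * ((v - u).natAbs * 2 ^ (l - j)) := Nat.mul_le_mul_left _ h
    _ = _ := by rw [e]; ring

theorem card_separates_le {l j : ℕ} (hj : j ≤ l) (p q : Fin (2 ^ l) × Fin (2 ^ l)) :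
    2 ^ j * (Finset.univ.filter fun s => gridCell s j p ≠ gridCell s j q).card
      ≤ gridDist p q * (2 ^ l) ^ 2 := by
  have key : ∀ u v : ℤ, 2 ^ j * (Finset.univ.filter fun s : Fin (2 ^ l) =>
      (u - (s : ℕ)) / ((2 ^ j : ℕ) : ℤ) ≠ (v - (s : ℕ)) / ((2 ^ j : ℕ) : ℤ)).card
        ≤ (u - v).natAbs * 2 ^ l := by
    intro u v
    rcases le_total u v with h | h
    · rw [show (u - v).natAbs = (v - u).natAbs by omega]
      exact card_coord_separates_le hj u v h
    · simpa only [ne_comm] using card_coord_separates_le hj v u h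
  have h1 := key (p.1 : ℕ) (q.1 : ℕ)
  have h2 := key (p.2 : ℕ) (q.2 : ℕ)
  have h3 := card_filter_or_le
    (fun s : Fin (2 ^ l) => (((p.1 : ℕ) : ℤ) - (s : ℕ)) / ((2 ^ j : ℕ) : ℤ) ≠
      (((q.1 : ℕ) : ℤ) - (s : ℕ)) / ((2 ^ j : ℕ) : ℤ))
    (fun s : Fin (2 ^ l) => (((p.2 : ℕ) : ℤ) - (s : ℕ)) / ((2 ^ j : ℕ) : ℤ) ≠
      (((q.2 : ℕ) : ℤ) - (s : ℕ)) / ((2 ^ j : ℕ) : ℤ))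
  have e : (Finset.univ.filter fun s => gridCell s j p ≠ gridCell s j q).card =
      (Finset.univ.filter fun s : Fin (2 ^ l) × Fin (2 ^ l) =>
        (((p.1 : ℕ) : ℤ) - (s.1 : ℕ)) / ((2 ^ j : ℕ) : ℤ) ≠
          (((q.1 : ℕ) : ℤ) - (s.1 : ℕ)) / ((2 ^ j : ℕ) : ℤ) ∨
        (((p.2 : ℕ) : ℤ) - (s.2 : ℕ)) / ((2 ^ j : ℕ) : ℤ) ≠
          (((q.2 : ℕ) : ℤ) - (s.2 : ℕ)) / ((2 ^ j : ℕ) : ℤ)).card := by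
    congr 1
    ext s
    simp only [gridCell, Finset.mem_filter, Finset.mem_univ, true_and, ne_eq, Prod.mk.injEq]
    tauto
  rw [e]
  refine (Nat.mul_le_mul_left _ h3).trans ?_
  rw [gridDist, mul_add, ← mul_assoc, ← mul_assoc]
  nlinarith [Nat.mul_le_mul_right (2 ^ l) h1, Nat.mul_le_mul_right (2 ^ l) h2]

/-- A random shift puts `p` within distance `R` of a cell boundary with probability at most
`4 * R / 2 ^ j`. -/
theorem card_near_boundary_le {l j : ℕ} (hj : j ≤ l) (p : Fin (2 ^ l) × Fin (2 ^ l)) (R : ℕ) :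
    2 ^ j * (Finset.univ.filter fun s =>
      ∃ q, gridDist p q ≤ R ∧ gridCell s j p ≠ gridCell s j q).card ≤ 4 * R * (2 ^ l) ^ 2 := by
  have key : ∀ u : ℤ, 2 ^ j * (Finset.univ.filter fun s : Fin (2 ^ l) =>
      (u - R - (s : ℕ)) / ((2 ^ j : ℕ) : ℤ) ≠ (u + R - (s : ℕ)) / ((2 ^ j : ℕ) : ℤ)).card
        ≤ 2 * R * 2 ^ l := by
    intro u
    have h := card_coord_separates_le hj (u - R) (u + R) (by omega)
    rwa [show (u + (R : ℤ) - (u - R)).natAbs = 2 * R by omega] at h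
  have h1 := key (p.1 : ℕ)
  have h2 := key (p.2 : ℕ)
  have h3 := card_filter_or_le
    (fun s : Fin (2 ^ l) => (((p.1 : ℕ) : ℤ) - R - (s : ℕ)) / ((2 ^ j : ℕ) : ℤ) ≠
      (((p.1 : ℕ) : ℤ) + R - (s : ℕ)) / ((2 ^ j : ℕ) : ℤ))
    (fun s : Fin (2 ^ l) => (((p.2 : ℕ) : ℤ) - R - (s : ℕ)) / ((2 ^ j : ℕ) : ℤ) ≠
      (((p.2 : ℕ) : ℤ) + R - (s : ℕ)) / ((2 ^ j : ℕ) : ℤ))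
  have squeeze : ∀ u v s : ℤ, (u - v).natAbs ≤ R →
      (u - R - s) / ((2 ^ j : ℕ) : ℤ) = (u + R - s) / ((2 ^ j : ℕ) : ℤ) →
      (u - s) / ((2 ^ j : ℕ) : ℤ) = (v - s) / ((2 ^ j : ℕ) : ℤ) := by
    intro u v s huv h
    have hpos : (0 : ℤ) < ((2 ^ j : ℕ) : ℤ) := by positivity
    have a1 := Int.ediv_le_ediv hpos (show u - R - s ≤ u - s by omega)
    have a2 := Int.ediv_le_ediv hpos (show u - s ≤ u + R - s by omega)
    have a3 := Int.ediv_le_ediv hpos (show u - R - s ≤ v - s by omega)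
    have a4 := Int.ediv_le_ediv hpos (show v - s ≤ u + R - s by omega)
    omega
  have hsub := Finset.card_le_card (s := Finset.univ.filter fun s =>
      ∃ q, gridDist p q ≤ R ∧ gridCell s j p ≠ gridCell s j q)
    (t := Finset.univ.filter fun s : Fin (2 ^ l) × Fin (2 ^ l) =>
        (((p.1 : ℕ) : ℤ) - R - (s.1 : ℕ)) / ((2 ^ j : ℕ) : ℤ) ≠
          (((p.1 : ℕ) : ℤ) + R - (s.1 : ℕ)) / ((2 ^ j : ℕ) : ℤ) ∨
        (((p.2 : ℕ) : ℤ) - R - (s.2 : ℕ)) / ((2 ^ j : ℕ) : ℤ) ≠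
          (((p.2 : ℕ) : ℤ) + R - (s.2 : ℕ)) / ((2 ^ j : ℕ) : ℤ)) (by
    intro s
    simp only [Finset.mem_filter, Finset.mem_univ, true_and]
    rintro ⟨q, hq, hne⟩
    by_contra! hcon
    refine hne (Prod.ext (squeeze _ _ _ ?_ hcon.1) (squeeze _ _ _ ?_ hcon.2))
    · exact le_trans (Nat.le_add_right _ _) hq
    · exact le_trans (Nat.le_add_left _ _) hq)
  refine (Nat.mul_le_mul_left _ (hsub.trans h3)).trans ?_
  rw [mul_add, ← mul_assoc, ← mul_assoc]
  nlinarith [Nat.mul_le_mul_right (2 ^ l) h1, Nat.mul_le_mul_right (2 ^ l) h2]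

theorem two_pow_clog_le {d : ℕ} (hd : 0 < d) : 2 ^ Nat.clog 2 d ≤ 2 * d := by
  rcases Nat.lt_or_ge 1 d with h | h
  · have h1 := Nat.pow_pred_clog_lt_self one_lt_two h
    have h2 := Nat.clog_pos one_lt_two h
    obtain ⟨m, hm⟩ := Nat.exists_eq_succ_of_ne_zero h2.ne'
    rw [hm] at h1 ⊢
    simp only [Nat.pred_succ, Nat.succ_eq_add_one] at h1
    rw [Nat.succ_eq_add_one, pow_succ]
    omega
  · obtain rfl : d = 1 := by omega
    simp

/-- Rounding positive distances up to powers of two within a window of `⌈log₂ N⌉ + 2` exponents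
increases their sum by a constant factor only. -/
theorem exists_exponents {N : ℕ} (hN : 0 < N) (d : Fin N → ℕ) :
    ∃ (i₀ : ℕ) (e : Fin N → ℕ), (∀ i, d i ≤ 2 ^ e i) ∧
      (∀ i, ∃ t < Nat.clog 2 N + 2, e i = i₀ + t) ∧
      ∑ i, (if 0 < d i then 2 ^ e i else 0) ≤ 4 * ∑ i, d i := by
  have : Nonempty (Fin N) := ⟨⟨0, hN⟩⟩
  obtain ⟨m, hm⟩ := Finite.exists_max d
  set D := d m
  set i₀ := Nat.log 2 (D / N)
  have hD : D ≤ 2 ^ (i₀ + (Nat.clog 2 N + 1)) := by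
    have h1 : D < N * (D / N + 1) := Nat.lt_mul_div_succ D hN
    have h2 : D / N + 1 ≤ 2 ^ (i₀ + 1) := Nat.lt_pow_succ_log_self one_lt_two _
    have h3 : N ≤ 2 ^ Nat.clog 2 N := Nat.le_pow_clog one_lt_two _
    calc D ≤ N * (D / N + 1) := h1.le
      _ ≤ 2 ^ Nat.clog 2 N * 2 ^ (i₀ + 1) := Nat.mul_le_mul h3 h2
      _ = _ := by rw [← pow_add]; congr 1; ring
  refine ⟨i₀, fun i => max i₀ (Nat.clog 2 (d i)), fun i => ?_, fun i => ?_, ?_⟩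
  · exact (Nat.le_pow_clog one_lt_two _).trans (Nat.pow_le_pow_right two_pos (le_max_right _ _))
  · have := Nat.clog_le_of_le_pow ((hm i).trans hD)
    refine ⟨max i₀ (Nat.clog 2 (d i)) - i₀, by omega, ?_⟩
    exact (Nat.add_sub_cancel' (le_max_left _ _)).symm
  · have hi₀ : 2 ^ i₀ ≤ 1 + D / N := by
      rcases Nat.eq_zero_or_pos (D / N) with h | h
      · simp [i₀, h]
      · exact (Nat.pow_log_le_self 2 h.ne').trans (Nat.le_add_left _ _)
    have hterm : ∀ i, (if 0 < d i then 2 ^ max i₀ (Nat.clog 2 (d i)) else 0)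
        ≤ 3 * d i + D / N := by
      intro i
      split_ifs with h
      · have h1 := two_pow_clog_le h
        rcases max_choice i₀ (Nat.clog 2 (d i)) with h2 | h2 <;> rw [h2] <;>
          linarith [Nat.zero_le (D / N)]
      · exact Nat.zero_le _
    calc _ ≤ ∑ i, (3 * d i + D / N) := Finset.sum_le_sum fun i _ => hterm i
      _ = 3 * ∑ i, d i + N * (D / N) := by
        rw [Finset.sum_add_distrib, Finset.mul_sum]; simp
      _ ≤ 3 * ∑ i, d i + ∑ i, d i := by
        refine Nat.add_le_add_left ((Nat.mul_div_le D N).trans ?_) _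
        exact Finset.single_le_sum (f := d) (fun _ _ => Nat.zero_le _) (Finset.mem_univ m)
      _ = _ := by ring

/-- Levels below `e` cost `2 ^ j` each, and the next `L` levels cost `d` each in expectation. -/
theorem sum_levels_le {l : ℕ} (p q : Fin (2 ^ l) × Fin (2 ^ l)) (e L : ℕ) :
    ∑ s, ∑ j ∈ Finset.range (l + 1),
      (if j < e + L ∧ gridCell s j p ≠ gridCell s j q then 2 ^ j else 0)
      ≤ ((if 0 < gridDist p q then 2 ^ e else 0) + L * gridDist p q) * (2 ^ l) ^ 2 := by
  set d := gridDist p q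
  rw [Finset.sum_comm]
  have hterm : ∀ j ∈ Finset.range (l + 1),
      ∑ s, (if j < e + L ∧ gridCell s j p ≠ gridCell s j q then 2 ^ j else 0) ≤
        (if j < e + L then (if j < e then (if 0 < d then 2 ^ j else 0) else d) else 0)
          * (2 ^ l) ^ 2 := by
    intro j hj
    have hc := card_separates_le (Nat.lt_succ_iff.1 (Finset.mem_range.1 hj)) p q
    by_cases h : j < e + L
    · simp only [h, true_and, if_true]
      rw [← Finset.sum_filter, Finset.sum_const, smul_eq_mul, mul_comm]
      split_ifs with h1 h2
      · refine Nat.mul_le_mul_left _ ((Finset.card_le_univ _).trans ?_)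
        simp [sq]
      · have : d = 0 := by omega
        simpa [d, this] using hc
      · exact hc
    · simp [h]
  refine (Finset.sum_le_sum hterm).trans ?_
  rw [← Finset.sum_mul]
  refine Nat.mul_le_mul_right _ ?_
  calc _ ≤ ∑ j ∈ Finset.range (e + L), (if j < e then (if 0 < d then 2 ^ j else 0) else d) := by
        rw [← Finset.sum_filter]
        refine Finset.sum_le_sum_of_subset fun j => ?_
        simp
    _ ≤ _ := by
        rw [Finset.sum_range_add]
        refine Nat.add_le_add ?_ ?_
        · rw [Finset.sum_congr rfl (g := fun j => if 0 < d then 2 ^ j else 0) (fun j hj => by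
            simp [Finset.mem_range.1 hj])]
          split_ifs
          · have := Nat.geomSum_lt (m := 2) (n := e) (s := Finset.range e) le_rfl (by simp)
            exact this.le
          · simp
        · simp

/-- For at least 99 percent of the shifts, the total size of the cells cutting a matching whose sources
occupy at most `k` points is at most `200 * (L + 4)` times its length. -/
theorem card_bad_shifts_le {l N k L : ℕ} (hN : 0 < N) (hk : 0 < k)
    (x y : Fin N → Fin (2 ^ l) × Fin (2 ^ l)) (hx : (Finset.univ.image x).card ≤ k)
    (hL : 800 * (k * (Nat.clog 2 N + 2)) ≤ 2 ^ L) :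
    100 * (Finset.univ.filter fun s => 200 * ((L + 4) * ∑ i, gridDist (x i) (y i)) <
      ∑ j ∈ Finset.range (l + 1), 2 ^ j *
        (Finset.univ.filter fun i => gridCell s j (x i) ≠ gridCell s j (y i)).card).card
      ≤ (2 ^ l) ^ 2 := by
  obtain ⟨i₀, e, hde, he, hsum⟩ := exists_exponents hN fun i => gridDist (x i) (y i)
  set S := ∑ i, gridDist (x i) (y i)
  set W := (2 ^ l) ^ 2
  set T := Nat.clog 2 N + 2
  let F : Fin (2 ^ l) × Fin (2 ^ l) → ℕ := fun s => ∑ i, ∑ j ∈ Finset.range (l + 1),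
    (if j < e i + L ∧ gridCell s j (x i) ≠ gridCell s j (y i) then 2 ^ j else 0)
  have hF : ∑ s, F s ≤ (L + 4) * S * W := by
    rw [Finset.sum_comm]
    refine (Finset.sum_le_sum fun i _ => sum_levels_le (x i) (y i) (e i) L).trans ?_
    rw [← Finset.sum_mul, Finset.sum_add_distrib, ← Finset.mul_sum]
    refine Nat.mul_le_mul_right _ ((Nat.add_le_add_right hsum _).trans_eq ?_)
    ring
  let B₁ := Finset.univ.filter fun s => 200 * ((L + 4) * S) < F s
  have hB₁ : 200 * B₁.card ≤ W := by
    have h1 : B₁.card * (200 * ((L + 4) * S) + 1) ≤ (L + 4) * S * W := by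
      calc _ = ∑ s ∈ B₁, (200 * ((L + 4) * S) + 1) := by simp
        _ ≤ ∑ s ∈ B₁, F s := Finset.sum_le_sum fun s hs => (Finset.mem_filter.1 hs).2
        _ ≤ ∑ s, F s := Finset.sum_le_sum_of_subset (Finset.subset_univ _)
        _ ≤ _ := hF
    rcases Nat.eq_zero_or_pos ((L + 4) * S) with h | h
    · rw [h] at h1
      have : B₁.card = 0 := by simpa using h1
      simp [this]
    · refine Nat.le_of_mul_le_mul_left ?_ h
      nlinarith
  let near : (Fin (2 ^ l) × Fin (2 ^ l)) × ℕ → Finset (Fin (2 ^ l) × Fin (2 ^ l)) := fun z =>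
    Finset.univ.filter fun s => i₀ + z.2 + L ≤ l ∧ ∃ q, gridDist z.1 q ≤ 2 ^ (i₀ + z.2) ∧
      gridCell s (i₀ + z.2 + L) z.1 ≠ gridCell s (i₀ + z.2 + L) q
  have hnear : ∀ z, 2 ^ L * (near z).card ≤ 4 * W := by
    intro z
    by_cases h : i₀ + z.2 + L ≤ l
    · have h1 := card_near_boundary_le h z.1 (2 ^ (i₀ + z.2))
      simp only [near, h, true_and]
      refine Nat.le_of_mul_le_mul_left ?_ (pow_pos two_pos (i₀ + z.2))
      rw [← mul_assoc, ← pow_add]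
      exact h1.trans_eq (by ring)
    · simp [near, h]
  let B₂ := (Finset.univ.image x ×ˢ Finset.range T).biUnion near
  have hB₂ : 200 * B₂.card ≤ W := by
    have h1 : 2 ^ L * B₂.card ≤ k * T * (4 * W) := by
      calc _ ≤ 2 ^ L * ∑ z ∈ Finset.univ.image x ×ˢ Finset.range T, (near z).card :=
            Nat.mul_le_mul_left _ Finset.card_biUnion_le
        _ ≤ ∑ z ∈ Finset.univ.image x ×ˢ Finset.range T, 4 * W := by
            rw [Finset.mul_sum]
            exact Finset.sum_le_sum fun z _ => hnear z
        _ ≤ _ := by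
            rw [Finset.sum_const, smul_eq_mul, Finset.card_product, Finset.card_range]
            exact Nat.mul_le_mul_right _ (Nat.mul_le_mul_right _ hx)
    have h2 : 0 < k * T := Nat.mul_pos hk (Nat.succ_pos _)
    refine Nat.le_of_mul_le_mul_left ?_ h2
    have h3 := Nat.mul_le_mul_right B₂.card hL
    linarith
  refine (Nat.mul_le_mul_left 100 ((Finset.card_le_card (t := B₁ ∪ B₂) fun s hs => ?_).trans
    (Finset.card_union_le B₁ B₂))).trans (by omega)
  by_cases hs₂ : s ∈ B₂
  · exact Finset.mem_union_right _ hs₂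
  refine Finset.mem_union_left _ (Finset.mem_filter.2 ⟨Finset.mem_univ _, ?_⟩)
  refine (Finset.mem_filter.1 hs).2.trans_eq ?_
  rw [show F s = _ from Finset.sum_comm]
  refine Finset.sum_congr rfl fun j hj => ?_
  rw [← Finset.sum_filter, Finset.sum_const, smul_eq_mul, mul_comm]
  congr 2
  ext i
  simp only [Finset.mem_filter, Finset.mem_univ, true_and]
  refine ⟨fun hne => ⟨?_, hne⟩, fun h => h.2⟩
  by_contra! hlt
  obtain ⟨t, ht, het⟩ := he i
  refine hs₂ (Finset.mem_biUnion.2 ⟨(x i, t), ?_, ?_⟩)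
  · simp [ht]
  · simp only [near, Finset.mem_filter, Finset.mem_univ, true_and, ← het]
    exact ⟨hlt.trans (Nat.lt_succ_iff.1 (Finset.mem_range.1 hj)), y i, hde i,
      fun h => hne (gridCell_eq_of_le hlt h)⟩

theorem gridEmbNorm_le {l N : ℕ} (s : Fin (2 ^ l) × Fin (2 ^ l))
    (μ ν : Fin (2 ^ l) × Fin (2 ^ l) → ℝ) (x y : Fin N → Fin (2 ^ l) × Fin (2 ^ l))
    (hμ : ∀ p, μ p = ((Finset.univ.filter fun i => x i = p).card : ℝ) / N)
    (hν : ∀ p, ν p = ((Finset.univ.filter fun i => y i = p).card : ℝ) / N) :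
    gridEmbNorm l (((s.1 : ℕ) : ℤ), ((s.2 : ℕ) : ℤ)) (fun p => μ p - ν p) ≤
      2 / N * ((∑ j ∈ Finset.range (l + 1), 2 ^ j *
        (Finset.univ.filter fun i => gridCell s j (x i) ≠ gridCell s j (y i)).card : ℕ) : ℝ) := by
  unfold gridEmbNorm
  simp only [cellOf_toPlane]
  push_cast
  rw [Finset.mul_sum]
  refine Finset.sum_le_sum fun j _ => ?_
  rw [mul_left_comm]
  refine mul_le_mul_of_nonneg_left ?_ (by positivity)
  have mass : ∀ (z : Fin N → Fin (2 ^ l) × Fin (2 ^ l)) (ρ : Fin (2 ^ l) × Fin (2 ^ l) → ℝ),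
      (∀ p, ρ p = ((Finset.univ.filter fun i => z i = p).card : ℝ) / N) → ∀ c : ℤ × ℤ,
      ∑ p ∈ Finset.univ.filter (fun p => gridCell s j p = c), ρ p =
        (∑ i, if gridCell s j (z i) = c then (1 : ℝ) else 0) / N := by
    intro z ρ hρ c
    simp only [hρ, ← Finset.sum_div, Finset.card_filter]
    push_cast
    rw [Finset.sum_comm]
    congr 1
    refine Finset.sum_congr rfl fun i _ => ?_
    simp
  have hcell : ∀ c : ℤ × ℤ,
      |∑ p ∈ Finset.univ.filter (fun p => gridCell s j p = c), (μ p - ν p)| ≤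
        (∑ i, if gridCell s j (x i) ≠ gridCell s j (y i) then
          ((if gridCell s j (x i) = c then (1 : ℝ) else 0) +
            (if gridCell s j (y i) = c then (1 : ℝ) else 0)) else 0) / N := by
    intro c
    rw [Finset.sum_sub_distrib, mass x μ hμ, mass y ν hν, ← sub_div, ← Finset.sum_sub_distrib,
      abs_div, Nat.abs_cast]
    gcongr
    refine (Finset.abs_sum_le_sum_abs _ _).trans (Finset.sum_le_sum fun i _ => ?_)
    by_cases h : gridCell s j (x i) = gridCell s j (y i)
    · simp [h]
    · simp only [ne_eq, h, not_false_eq_true, if_true]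
      split_ifs <;> norm_num
  refine (Finset.sum_le_sum fun c _ => hcell c).trans ?_
  rw [← Finset.sum_div, Finset.sum_comm, div_mul_eq_mul_div]
  gcongr
  rw [Finset.card_filter]
  push_cast
  rw [Finset.mul_sum]
  refine Finset.sum_le_sum fun i _ => ?_
  by_cases h : gridCell s j (x i) = gridCell s j (y i)
  · simp [h]
  · simp only [ne_eq, h, not_false_eq_true, if_true, Finset.sum_add_distrib, Finset.sum_ite_eq]
    split_ifs <;> norm_num

theorem clog_le_of_bounds {N k : ℕ} (hN : 2 ≤ N) (hk : 2 ≤ k) :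
    (Nat.clog 2 (800 * (k * (Nat.clog 2 N + 2))) : ℝ) + 4 ≤
      18 * (Real.logb 2 k + Real.logb 2 (Real.logb 2 N)) := by
  have clog_le : ∀ d : ℕ, 0 < d → (Nat.clog 2 d : ℝ) ≤ 1 + Real.logb 2 d := by
    intro d hd
    have hd' : (0 : ℝ) < d := by exact_mod_cast hd
    have h : ((2 : ℝ) ^ (Nat.clog 2 d : ℕ)) ≤ 2 * d := by exact_mod_cast two_pow_clog_le hd
    have h2 := Real.logb_le_logb_of_le one_lt_two (by positivity) h
    rwa [Real.logb_pow, Real.logb_self_eq_one one_lt_two, mul_one,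
      Real.logb_mul two_ne_zero hd'.ne', Real.logb_self_eq_one one_lt_two] at h2
  have one_le : ∀ d : ℕ, 2 ≤ d → 1 ≤ Real.logb 2 d := by
    intro d hd
    rw [← Real.logb_self_eq_one (b := 2) one_lt_two]
    exact Real.logb_le_logb_of_le one_lt_two two_pos (by exact_mod_cast hd)
  have hN1 := one_le N hN
  have hk1 := one_le k hk
  have hll : 0 ≤ Real.logb 2 (Real.logb 2 N) := Real.logb_nonneg one_lt_two hN1
  have hk0 : (0 : ℝ) < k := by positivity
  have h1 := clog_le (800 * (k * (Nat.clog 2 N + 2))) (by positivity)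
  have h2 := clog_le N (by omega)
  have h3 : ((800 * (k * (Nat.clog 2 N + 2)) : ℕ) : ℝ) ≤ 2 ^ 12 * (k * Real.logb 2 N) := by
    push_cast
    nlinarith
  have h4 := Real.logb_le_logb_of_le (b := 2) one_lt_two (by positivity) h3
  rw [Real.logb_mul (by norm_num) (by positivity), Real.logb_mul hk0.ne' (by positivity),
    Real.logb_pow, Real.logb_self_eq_one one_lt_two] at h4
  push_cast at h1 h4
  linarith

/-- Lemma `grid_granular`: if `μ, ν` are probability measures on `{0,…,Δ−1}²` (`Δ = 2^l`)
whose weights are all multiples of `1/N`, and `μ` is `k`-sparse with `k ≤ N`, then for a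
uniformly random shift `s ∈ {0,…,Δ−1}²`, with probability at least `0.99`,
`‖G_s(μ − ν)‖₁ ≤ O(log k + log log N) ⋅ EMD(μ, ν)`. -/
theorem stmt_9 : ∃ C : ℝ, 0 < C ∧
    ∀ (l N k : ℕ), 2 ≤ N → 2 ≤ k → k ≤ N →
    ∀ μ ν : Fin (2 ^ l) × Fin (2 ^ l) → ℝ,
      (∀ p, 0 ≤ μ p) → (∀ p, 0 ≤ ν p) →
      (∑ p, μ p = 1) → (∑ p, ν p = 1) →
      (∀ p, ∃ a : ℕ, μ p = (a : ℝ) / N) →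
      (∀ p, ∃ a : ℕ, ν p = (a : ℝ) / N) →
      (Finset.univ.filter fun p => μ p ≠ 0).card ≤ k →
      (0.99 : ℝ) ≤
        ((Finset.univ.filter fun s : Fin (2 ^ l) × Fin (2 ^ l) =>
            gridEmbNorm l ((s.1 : ℤ), (s.2 : ℤ)) (fun p => μ p - ν p) ≤
              C * (Real.logb 2 k + Real.logb 2 (Real.logb 2 N)) *
                EMDgrid (2 ^ l) μ ν).card : ℝ) / ((2 : ℝ) ^ l) ^ 2 := by
  refine ⟨7200, by norm_num, ?_⟩
  intro l N k hN hk _ μ ν hμ0 hν0 hμ1 hν1 hμN hνN hsupp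
  have hN0 : 0 < N := by omega
  obtain ⟨x, y, hx, hy, hmin⟩ := exists_matching (fun p q => (gridDist p q : ℝ)) N hN0 μ ν
    hμ1 hν1 hμN hνN
  set S := ∑ i, gridDist (x i) (y i) with hS
  set E := EMDgrid (2 ^ l) μ ν with hE
  have hSE : (S : ℝ) / N ≤ E := by
    refine le_csInf ⟨_, fun p q => μ p * ν q, fun p q => mul_nonneg (hμ0 p) (hν0 q),
      fun p => by rw [← Finset.mul_sum, hν1, mul_one],
      fun q => by rw [← Finset.sum_mul, hμ1, one_mul], rfl⟩ ?_
    rintro c ⟨π, h0, h1, h2, rfl⟩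
    simp only [← cast_gridDist]
    have h := hmin π h0 h1 h2
    rw [hS]
    push_cast
    exact h
  set L := Nat.clog 2 (800 * (k * (Nat.clog 2 N + 2)))
  have hximg : (Finset.univ.image x).card ≤ k := by
    refine le_trans (Finset.card_le_card fun p hp => ?_) hsupp
    obtain ⟨i, -, rfl⟩ := Finset.mem_image.1 hp
    have : 0 < (Finset.univ.filter fun j => x j = x i).card := Finset.card_pos.2 ⟨i, by simp⟩
    simp only [Finset.mem_filter, Finset.mem_univ, true_and, hx]
    positivity
  have hbad := card_bad_shifts_le hN0 (by omega) x y hximg (Nat.le_pow_clog one_lt_two _ :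
    _ ≤ 2 ^ L)
  set bad := Finset.univ.filter fun s => 200 * ((L + 4) * S) <
    ∑ j ∈ Finset.range (l + 1), 2 ^ j *
      (Finset.univ.filter fun i => gridCell s j (x i) ≠ gridCell s j (y i)).card with hbad_def
  rw [le_div_iff₀ (by positivity)]
  have hgood : (badᶜ.card : ℝ) ≤ ((Finset.univ.filter fun s : Fin (2 ^ l) × Fin (2 ^ l) =>
      gridEmbNorm l ((s.1 : ℤ), (s.2 : ℤ)) (fun p => μ p - ν p) ≤
        7200 * (Real.logb 2 k + Real.logb 2 (Real.logb 2 N)) * E).card : ℝ) := by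
    refine Nat.cast_le.2 (Finset.card_le_card fun s hs => ?_)
    simp only [hbad_def, Finset.mem_compl, Finset.mem_filter, Finset.mem_univ, true_and,
      not_lt] at hs ⊢
    refine (gridEmbNorm_le s μ ν x y hx hy).trans ?_
    have hs' : ((∑ j ∈ Finset.range (l + 1), 2 ^ j *
        (Finset.univ.filter fun i => gridCell s j (x i) ≠ gridCell s j (y i)).card : ℕ) : ℝ)
        ≤ 200 * ((L + 4) * S) := by exact_mod_cast hs
    have hE0 : 0 ≤ E := le_trans (by positivity) hSE
    calc _ ≤ 2 / (N : ℝ) * (200 * ((L + 4) * S)) := by gcongr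
      _ = 400 * (L + 4) * (S / N) := by ring
      _ ≤ 400 * (18 * (Real.logb 2 k + Real.logb 2 (Real.logb 2 N))) * E := by
        have h := clog_le_of_bounds hN hk
        have h0 : (0 : ℝ) ≤ 18 * (Real.logb 2 k + Real.logb 2 (Real.logb 2 N)) :=
          le_trans (by positivity) h
        have h1 : (0 : ℝ) ≤ 400 * (18 * (Real.logb 2 k + Real.logb 2 (Real.logb 2 N))) := by
          linarith
        gcongr
      _ = _ := by ring
  refine le_trans ?_ hgood
  have hcompl : (badᶜ.card : ℝ) = (2 ^ l) ^ 2 - bad.card := by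
    rw [Finset.card_compl, Nat.cast_sub (Finset.card_le_univ _)]
    simp [sq]
  have hbad' : 100 * (bad.card : ℝ) ≤ (2 ^ l) ^ 2 := by exact_mod_cast hbad
  rw [hcompl]
  linarith
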